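/- Let C ⊆ ℝ be a compact set and let (xₙ) be a sequence of real numbers converging to 0 such that xₙ ∉ C − C for every n. Then for every k ∈ ℕ there exist indices n₁ < n₂ < ⋯ < n_k such that the translates x_{n₁} + C, x_{n₂} + C, …, x_{n_k} + C are pairwise disjoint. -/

import Mathlib

open Set Filter Topology

theorem disjoint_translates (C : Set ℝ) (hC : IsCompact C)
    (x : ℕ → ℝ) (hx : Tendsto x atTop (𝓝 0))
    (hnot : ∀ n : ℕ, x n ∉ {z : ℝ | ∃ a ∈ C, ∃ b ∈ C, z = a - b}) :
    ∀ k : ℕ, ∃ n : Fin k → ℕ, StrictMono n ∧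
      Pairwise fun i j =>
        Disjoint ((fun c => x (n i) + c) '' C) ((fun c => x (n j) + c) '' C) := by
  have hclosed : IsClosed {z : ℝ | ∃ a ∈ C, ∃ b ∈ C, z = a - b} := by
    have h : {z : ℝ | ∃ a ∈ C, ∃ b ∈ C, z = a - b} = (fun p : ℝ × ℝ => p.1 - p.2) '' C ×ˢ C := by
      ext z
      simp only [mem_ofPred_eq, mem_image, mem_prod, Prod.exists]
      grind
    rw [h]
    exact ((hC.prod hC).image (by fun_prop)).isClosed
  have hev (m : ℕ) : ∀ᶠ n in atTop, m < n ∧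
      Disjoint ((fun c => x m + c) '' C) ((fun c => x n + c) '' C) := by
    have hlim : Tendsto (fun n => x m - x n) atTop (𝓝 (x m)) := by
      simpa using hx.const_sub (x m)
    filter_upwards [eventually_gt_atTop m, hlim (hclosed.isOpen_compl.mem_nhds (hnot m))]
      with n hmn hn
    refine ⟨hmn, Set.disjoint_left.2 ?_⟩
    rintro _ ⟨b, hb, rfl⟩ ⟨a, ha, hab⟩
    exact hn ⟨a, ha, b, hb, by linarith [show x n + a = x m + b from hab]⟩
  obtain ⟨f, -, hf⟩ := exists_seq_of_forall_finset_exists (fun _ : ℕ => True)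
    (fun m n => m < n ∧ Disjoint ((fun c => x m + c) '' C) ((fun c => x n + c) '' C))
    fun s _ => by
      obtain ⟨n, hn⟩ := ((Finset.eventually_all s).2 fun m _ => hev m).exists
      exact ⟨n, trivial, hn⟩
  intro k
  refine ⟨fun i => f i, fun i j hij => (hf i j hij).1, fun i j hij => ?_⟩
  rcases lt_or_gt_of_ne hij with h | h
  · exact (hf i j h).2
  · exact (hf j i h).2.symm
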